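/- For each n ≥ 3 there exist nonempty words p₁, p₂, …, pₙ, qₙ ∈ A⁺ such that the Zimin word zₙ factors as zₙ = p₁·(p₂p₁)·(p₃p₂)⋯(pₙpₙ₋₁)·qₙ, and moreover: (I) con(pᵢ) ⊆ {x₁, x₂, …, xᵢ} for each i ∈ {1, …, n}; (II) occ(xᵢ, pᵢ) = 1 for each i ∈ {1, …, n}; (III) con(qₙ) ⊆ {x₁, x₂, …, xₙ₋₂}. -/

import Mathlib

abbrev Word : Type := FreeMonoid ℕ

/-- The Zimin words over the variables `xᵢ = i`:
`z₁ = x₁` and `zₙ₊₁ = zₙ·xₙ₊₁·zₙ`. -/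
def zimin : ℕ → Word
  | 0 => 1
  | 1 => FreeMonoid.of 1
  | n + 2 => zimin (n + 1) * FreeMonoid.of (n + 2) * zimin (n + 1)

/-- The content of a word: the set of variables occurring in it. -/
def con (w : Word) : Set ℕ := {a | a ∈ FreeMonoid.toList w}

/-- The number of occurrences of the variable `x` in the word `w`. -/
def occ (x : ℕ) (w : Word) : ℕ := (FreeMonoid.toList w).count x

/-- The data of a factorization `zₘ₊₂ = pre * right * left * tail` of a Zimin word whose last two
blocks are `right = pₘ₊₂` and `left = pₘ₊₁`. -/
structure ZiminSplit where
  pre : Word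
  left : Word
  right : Word
  tail : Word

/-- The factorization of `zₘ₊₂`; that of `zₘ₊₃ = zₘ₊₂·xₘ₊₃·zₘ₊₂` is obtained by splitting both
copies of `zₘ₊₂`. -/
def ziminSplit : ℕ → ZiminSplit
  | 0 => ⟨FreeMonoid.of 1, FreeMonoid.of 1, FreeMonoid.of 2, 1⟩
  | m + 1 =>
    let s := ziminSplit m
    ⟨s.pre * (s.right * s.left), s.right, s.tail * FreeMonoid.of (m + 3) * s.pre, s.left * s.tail⟩

theorem con_one : con 1 = ∅ := by
  ext; simp [con]

theorem con_of (x : ℕ) : con (FreeMonoid.of x) = {x} := by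
  ext; simp [con]

theorem con_mul (v w : Word) : con (v * w) = con v ∪ con w := by
  ext; simp [con]

theorem occ_of_self (x : ℕ) : occ x (FreeMonoid.of x) = 1 := by
  simp [occ]

theorem occ_mul (x : ℕ) (v w : Word) : occ x (v * w) = occ x v + occ x w := by
  simp [occ]

theorem occ_eq_zero {x : ℕ} {w : Word} (h : x ∉ con w) : occ x w = 0 :=
  List.count_eq_zero_of_not_mem h

theorem ne_one_of_occ_eq_one {x : ℕ} {w : Word} (h : occ x w = 1) : w ≠ 1 := by
  rintro rfl
  simp [occ] at h

theorem zimin_eq_ziminSplit (m : ℕ) :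
    zimin (m + 2) = (ziminSplit m).pre * ((ziminSplit m).right * (ziminSplit m).left) *
      (ziminSplit m).tail := by
  induction m with
  | zero => simp [zimin, ziminSplit, mul_assoc]
  | succ m ih =>
    rw [zimin, ih]
    simp only [ziminSplit, mul_assoc]

theorem ziminSplit_pre (m : ℕ) :
    (ziminSplit m).pre = FreeMonoid.of 1 *
      ((List.range m).map fun j => (ziminSplit (j + 1)).left * (ziminSplit j).left).prod := by
  induction m with
  | zero => simp [ziminSplit]
  | succ m ih =>
    rw [List.range_succ, List.map_append, List.prod_append, ← mul_assoc, ← ih]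
    simp [ziminSplit]

theorem con_ziminSplit (m : ℕ) :
    con (ziminSplit m).pre ⊆ Set.Icc 1 (m + 2) ∧ con (ziminSplit m).left ⊆ Set.Icc 1 (m + 1) ∧
      con (ziminSplit m).right ⊆ Set.Icc 1 (m + 2) ∧ con (ziminSplit m).tail ⊆ Set.Icc 1 m := by
  induction m with
  | zero => simp [ziminSplit, con_one, con_of]
  | succ m ih =>
    obtain ⟨hpre, hleft, hright, htail⟩ := ih
    have mono {w : Word} {k l : ℕ} (h : con w ⊆ Set.Icc 1 k) (hkl : k ≤ l) :
        con w ⊆ Set.Icc 1 l := h.trans (Set.Icc_subset_Icc_right hkl)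
    simp only [ziminSplit, con_mul, con_of, Set.union_subset_iff, Set.singleton_subset_iff]
    exact ⟨⟨mono hpre (by lia), mono hright (by lia), mono hleft (by lia)⟩, hright,
      ⟨⟨mono htail (by lia), by simp⟩, mono hpre (by lia)⟩, hleft, mono htail (by lia)⟩

theorem occ_ziminSplit_right (m : ℕ) : occ (m + 2) (ziminSplit m).right = 1 := by
  cases m with
  | zero => exact occ_of_self 2
  | succ m =>
    have hpre : m + 3 ∉ con (ziminSplit m).pre := fun h => by
      simpa using (con_ziminSplit m).1 h
    have htail : m + 3 ∉ con (ziminSplit m).tail := fun h => by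
      simpa using (con_ziminSplit m).2.2.2 h
    simp only [ziminSplit, occ_mul, occ_eq_zero hpre, occ_eq_zero htail]
    simp [occ_of_self]

theorem occ_ziminSplit_left (m : ℕ) : occ (m + 1) (ziminSplit m).left = 1 := by
  cases m with
  | zero => exact occ_of_self 1
  | succ m => exact occ_ziminSplit_right m

theorem ziminSplit_tail_ne_one (m : ℕ) : (ziminSplit (m + 1)).tail ≠ 1 := by
  refine ne_one_of_occ_eq_one (x := m + 1) ?_
  have htail : m + 1 ∉ con (ziminSplit m).tail := fun h => by
    simpa using (con_ziminSplit m).2.2.2 h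
  simp only [ziminSplit, occ_mul, occ_eq_zero htail, occ_ziminSplit_left]

/-- For each `n ≥ 3`, the Zimin word `zₙ` factors as
`zₙ = p₁·(p₂p₁)·(p₃p₂)⋯(pₙpₙ₋₁)·qₙ` with nonempty words `pᵢ`, `qₙ` such that
`con(pᵢ) ⊆ {x₁, …, xᵢ}`, `occ(xᵢ, pᵢ) = 1`, and `con(qₙ) ⊆ {x₁, …, xₙ₋₂}`. -/
theorem statement9 (n : ℕ) (hn : 3 ≤ n) :
    ∃ (p : ℕ → Word) (q : Word),
      (∀ i : ℕ, 1 ≤ i → i ≤ n → p i ≠ 1) ∧ q ≠ 1 ∧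
      zimin n =
        p 1 * ((List.range (n - 1)).map (fun j => p (j + 2) * p (j + 1))).prod * q ∧
      (∀ i : ℕ, 1 ≤ i → i ≤ n → con (p i) ⊆ {a | 1 ≤ a ∧ a ≤ i}) ∧
      (∀ i : ℕ, 1 ≤ i → i ≤ n → occ i (p i) = 1) ∧
      con q ⊆ {a | 1 ≤ a ∧ a ≤ n - 2} := by
  obtain ⟨m, rfl⟩ := Nat.exists_eq_add_of_le' hn
  have index {i : ℕ} (hi : 1 ≤ i) : i - 1 + 1 = i := Nat.sub_add_cancel hi
  have hocc (i : ℕ) (hi : 1 ≤ i) : occ i (ziminSplit (i - 1)).left = 1 := by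
    simpa only [index hi] using occ_ziminSplit_left (i - 1)
  refine ⟨fun i => (ziminSplit (i - 1)).left, (ziminSplit (m + 1)).tail,
    fun i hi _ => ne_one_of_occ_eq_one (hocc i hi), ziminSplit_tail_ne_one m, ?_, fun i hi _ => ?_,
    fun i hi _ => hocc i hi, (con_ziminSplit (m + 1)).2.2.2⟩
  · rw [zimin_eq_ziminSplit (m + 1)]
    exact congrArg (· * (ziminSplit (m + 1)).tail) (ziminSplit_pre (m + 2))
  · have := (con_ziminSplit (i - 1)).2.1
    rwa [index hi] at this
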